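/- Let F(λ) = (σ_k(λ)/σ_l(λ))^{1/(k-l)} for 0 ≤ l < k ≤ n. Then F is positive on Γ_k and monotone on Γ_k, i.e., ∂F/∂λ_i > 0 for all i and all λ ∈ Γ_k. -/

import Mathlib

/-- The `k`-th elementary symmetric polynomial of `x : Fin n → ℝ`. -/
def esymm (n : ℕ) (k : ℕ) (x : Fin n → ℝ) : ℝ :=
  ∑ s ∈ Finset.powersetCard k (Finset.univ : Finset (Fin n)), ∏ i ∈ s, x i

/-- The Garding cone `Γ_k`: all `σ_j > 0` for `1 ≤ j ≤ k`. -/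
def inGamma (n k : ℕ) (x : Fin n → ℝ) : Prop :=
  ∀ j : ℕ, 1 ≤ j → j ≤ k → 0 < esymm n j x

open Polynomial in
/-- By Rolle's theorem, the derivative of a real-rooted polynomial is real-rooted. -/
theorem Polynomial.Splits.derivative_real {p : ℝ[X]} (hp : p.Splits) : (derivative p).Splits := by
  rw [splits_iff_card_roots] at hp ⊢
  have h := card_roots_le_derivative p
  have h' := card_roots' (derivative p)
  have h'' := natDegree_derivative_le p
  by_cases h0 : p.natDegree = 0
  · rw [eq_C_of_natDegree_eq_zero h0]
    simp
  · omega

open Polynomial in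
/-- Laguerre's inequality at the origin for a real-rooted polynomial. -/
theorem Polynomial.Splits.two_mul_coeff_zero_mul_coeff_two_le {p : ℝ[X]} (hp : p.Splits) :
    2 * (p.coeff 0 * p.coeff 2) ≤ p.coeff 1 ^ 2 := by
  have key : ∀ m : Multiset ℝ, ∀ c : ℝ,
      2 * ((C c * (m.map (X - C ·)).prod).coeff 0 * (C c * (m.map (X - C ·)).prod).coeff 2) ≤
        (C c * (m.map (X - C ·)).prod).coeff 1 ^ 2 := by
    intro m c
    induction m using Multiset.induction with
    | empty => simp [coeff_C]
    | cons r m ih =>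
      rw [Multiset.map_cons, Multiset.prod_cons, mul_left_comm (C c)]
      generalize C c * (m.map (X - C ·)).prod = q at ih ⊢
      simp only [sub_mul, coeff_sub, coeff_C_mul, coeff_X_mul, coeff_X_mul_zero]
      nlinarith [sq_nonneg (q.coeff 0), mul_le_mul_of_nonneg_left ih (sq_nonneg r)]
  have h := key p.roots p.leadingCoeff
  rwa [← hp.eq_prod_roots] at h

open Polynomial in
/-- Newton's inequality for the coefficients of a real-rooted polynomial, with a constant
independent of the degree. -/
theorem Polynomial.Splits.newton_inequality {p : ℝ[X]} (hp : p.Splits) (j : ℕ) :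
    (j + 2) * (p.coeff j * p.coeff (j + 2)) ≤ (j + 1) * p.coeff (j + 1) ^ 2 := by
  induction j generalizing p with
  | zero => simpa using hp.two_mul_coeff_zero_mul_coeff_two_le
  | succ j ih =>
    have h := ih hp.derivative_real
    simp only [coeff_derivative] at h
    push_cast at h ⊢
    have hj : (0 : ℝ) < (j + 1) * (j + 2) := by positivity
    refine le_of_mul_le_mul_left ?_ hj
    ring_nf at h ⊢
    exact h

open Polynomial in
theorem Polynomial.Splits.coeff_mul_coeff_lt_sq {p : ℝ[X]} (hp : p.Splits) {j : ℕ}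
    (h : p.coeff (j + 1) ≠ 0) : p.coeff j * p.coeff (j + 2) < p.coeff (j + 1) ^ 2 := by
  have h₁ := hp.newton_inequality j
  have h₂ : 0 < p.coeff (j + 1) ^ 2 := by positivity
  have hj : (0 : ℝ) < j + 2 := by positivity
  refine lt_of_mul_lt_mul_left ?_ hj.le
  linarith

open Polynomial in
theorem Polynomial.Splits.coeff_mul_coeff_le_sq {p : ℝ[X]} (hp : p.Splits) (j : ℕ) :
    p.coeff j * p.coeff (j + 2) ≤ p.coeff (j + 1) ^ 2 := by
  by_cases h : p.coeff (j + 1) = 0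
  · have h₁ := hp.newton_inequality j
    have hj : (0 : ℝ) < j + 2 := by positivity
    rw [h] at h₁ ⊢
    refine le_of_mul_le_mul_left ?_ hj
    linarith
  · exact (hp.coeff_mul_coeff_lt_sq h).le

open Polynomial in
/-- Dividing a real-rooted polynomial by a linear factor `1 + t X` preserves positivity of the
leading block of coefficients, with one coefficient lost. -/
theorem Polynomial.Splits.coeff_pos_of_one_add_mul {p : ℝ[X]} (hp : p.Splits)
    (h0 : 0 < p.coeff 0) (t : ℝ) {m : ℕ}
    (h : ∀ j, j ≤ m + 1 → 0 < ((1 + C t * X) * p).coeff j) : ∀ j, j ≤ m → 0 < p.coeff j := by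
  intro j
  induction j with
  | zero => exact fun _ => h0
  | succ j ih =>
    intro hj
    have hpos := ih (by omega)
    have h₁ := h (j + 1) (by omega)
    have h₂ := h (j + 2) (by omega)
    simp only [add_mul, one_mul, mul_assoc, coeff_add, coeff_C_mul, coeff_X_mul] at h₁ h₂
    have hN := hp.coeff_mul_coeff_le_sq j
    by_contra! hle
    have h₃ := mul_nonneg (neg_nonneg.2 hle) h₁.le
    have h₄ := mul_pos hpos h₂
    nlinarith

open Polynomial in
/-- Consecutive coefficient ratios of a real-rooted polynomial strictly decrease along its leading
block of positive coefficients. -/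
theorem Polynomial.Splits.coeff_cross_mul_lt {p : ℝ[X]} (hp : p.Splits) {m : ℕ}
    (h : ∀ j, j ≤ m → 0 < p.coeff j) {l : ℕ} (hl : l + 1 ≤ m) :
    p.coeff (m + 1) * p.coeff l < p.coeff m * p.coeff (l + 1) := by
  induction m, hl using Nat.le_induction with
  | base =>
    have := hp.coeff_mul_coeff_lt_sq (h (l + 1) le_rfl).ne'
    linarith
  | succ m hm ih =>
    have h₁ := ih fun j hj => h j (by omega)
    have h₂ := hp.coeff_mul_coeff_lt_sq (h (m + 1) le_rfl).ne'
    have h₃ := mul_lt_mul_of_pos_left h₁ (h (m + 1) le_rfl)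
    have h₄ := mul_lt_mul_of_pos_right h₂ (h l (by omega))
    refine lt_of_mul_lt_mul_left ?_ (h m (by omega)).le
    linarith

open Polynomial in
theorem esymm_eq_coeff_prod (n k : ℕ) (x : Fin n → ℝ) :
    esymm n k x = (∏ i, (1 + C (x i) * X)).coeff k := by
  rw [Finset.prod_one_add, finsetSum_coeff, esymm, Finset.powersetCard_eq_filter,
    Finset.sum_filter]
  refine Finset.sum_congr rfl fun s _ => ?_
  rw [Finset.prod_mul_distrib, Finset.prod_const, ← map_prod, coeff_C_mul, coeff_X_pow]
  simp [eq_comm]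

open Polynomial in
theorem esymm_add_smul_single (n k : ℕ) (x : Fin n → ℝ) (i : Fin n) (t : ℝ) :
    esymm n k (x + t • Pi.single i 1) =
      ((1 + C (x i + t) * X) * ∏ j ∈ Finset.univ.erase i, (1 + C (x j) * X)).coeff k := by
  rw [esymm_eq_coeff_prod, ← Finset.mul_prod_erase _ _ (Finset.mem_univ i)]
  congr 2
  · simp
  · refine Finset.prod_congr rfl fun j hj => ?_
    simp [Finset.ne_of_mem_erase hj]

theorem esymm_zero (n : ℕ) (x : Fin n → ℝ) : esymm n 0 x = 1 := by
  simp [esymm]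

theorem inGamma.esymm_pos {n k j : ℕ} {x : Fin n → ℝ} (hx : inGamma n k x) (hj : j ≤ k) :
    0 < esymm n j x := by
  rcases Nat.eq_zero_or_pos j with rfl | h
  · simp [esymm_zero]
  · exact hx j h hj

theorem differentiable_esymm (n k : ℕ) : Differentiable ℝ (esymm n k) := by
  unfold esymm
  fun_prop

open Polynomial in
theorem hasDerivAt_esymm_add_smul_single (n k : ℕ) (x : Fin n → ℝ) (i : Fin n) :
    HasDerivAt (fun t : ℝ => esymm n k (x + t • Pi.single i 1))
      ((X * ∏ j ∈ Finset.univ.erase i, (1 + C (x j) * X)).coeff k) 0 := by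
  simp only [esymm_add_smul_single, add_mul, one_mul, mul_assoc, coeff_add, coeff_C_mul]
  simpa only [id, one_mul, add_mul] using
    (((hasDerivAt_id (0 : ℝ)).const_add (x i)).mul_const _).const_add _

open Polynomial in
/-- The numerator of `∂(σ_k / σ_l)/∂λ_i` is positive on `Γ_k`. -/
theorem inGamma.esymm_quotient_numerator_pos {n k l : ℕ} (hlk : l < k) {x : Fin n → ℝ}
    (hx : inGamma n k x) (i : Fin n) :
    0 < (X * ∏ j ∈ Finset.univ.erase i, (1 + C (x j) * X)).coeff k * esymm n l x -
      esymm n k x * (X * ∏ j ∈ Finset.univ.erase i, (1 + C (x j) * X)).coeff l := by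
  have hE : ∀ j, esymm n j x =
      ((1 + C (x i) * X) * ∏ j ∈ Finset.univ.erase i, (1 + C (x j) * X)).coeff j := fun j => by
    simpa using esymm_add_smul_single n j x i 0
  have hs : (∏ j ∈ Finset.univ.erase i, (1 + C (x j) * X)).Splits :=
    Splits.prod fun j _ => Splits.of_natDegree_le_one (by compute_degree)
  have h0 : (∏ j ∈ Finset.univ.erase i, (1 + C (x j) * X)).coeff 0 = 1 := by
    simp [coeff_zero_eq_eval_zero, eval_prod]
  have hpos : ∀ j, j ≤ k → 0 < esymm n j x := fun j => hx.esymm_pos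
  simp only [hE] at hpos ⊢
  generalize ∏ j ∈ Finset.univ.erase i, (1 + C (x j) * X) = p at *
  obtain ⟨m, rfl⟩ : ∃ m, k = m + 1 := ⟨k - 1, by omega⟩
  have hp := hs.coeff_pos_of_one_add_mul (h0 ▸ one_pos) (x i) hpos
  cases l with
  | zero => simpa [mul_coeff_zero, h0] using hp m le_rfl
  | succ l =>
    have h := hs.coeff_cross_mul_lt hp (l := l) (by omega)
    simp only [add_mul, one_mul, mul_assoc, coeff_add, coeff_C_mul, coeff_X_mul]
    linarith

/-- The operator `F(λ) = (σ_k(λ)/σ_l(λ))^{1/(k-l)}`, `0 ≤ l < k ≤ n`, is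
positive and monotone on `Γ_k`: `F > 0` and `∂F/∂λ_i > 0` for all `i`. -/
theorem quotient_operator_positive_monotone (n k l : ℕ) (hlk : l < k) (hkn : k ≤ n)
    (x : Fin n → ℝ) (hx : inGamma n k x) :
    0 < (esymm n k x / esymm n l x) ^ ((1 : ℝ) / ((k : ℝ) - l)) ∧
    ∀ i, 0 < fderiv ℝ
      (fun y : Fin n → ℝ => (esymm n k y / esymm n l y) ^ ((1 : ℝ) / ((k : ℝ) - l)))
      x (Pi.single i 1) := by
  have hk : 0 < esymm n k x := hx.esymm_pos le_rfl
  have hl : 0 < esymm n l x := hx.esymm_pos hlk.le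
  have hq : 0 < esymm n k x / esymm n l x := div_pos hk hl
  have hkl : (0 : ℝ) < k - l := sub_pos.2 (by exact_mod_cast hlk)
  refine ⟨Real.rpow_pos_of_pos hq _, fun i => ?_⟩
  have hd : DifferentiableAt ℝ
      (fun y : Fin n → ℝ => (esymm n k y / esymm n l y) ^ ((1 : ℝ) / ((k : ℝ) - l))) x :=
    ((differentiable_esymm n k x).mul ((differentiable_esymm n l x).inv hl.ne')).rpow_const
      (Or.inl hq.ne')
  have h := ((hasDerivAt_esymm_add_smul_single n k x i).div
    (hasDerivAt_esymm_add_smul_single n l x i) (by simpa using hl.ne')).rpow_const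
      (p := (1 : ℝ) / ((k : ℝ) - l)) (Or.inl (by simpa using hq.ne'))
  rw [← hd.lineDeriv_eq_fderiv, lineDeriv]
  refine lt_of_lt_of_eq ?_ h.deriv.symm
  have hnum := hx.esymm_quotient_numerator_pos hlk i
  simp only [Pi.div_apply, zero_smul, add_zero]
  have := Real.rpow_pos_of_pos hq ((1 : ℝ) / ((k : ℝ) - l) - 1)
  positivity
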